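/- Let G be a finite simple connected graph with adjacency matrix A and let u be a vertex of eccentricity e. Then the eigenvalue support of u has size at least e+1, i.e. |Φ_u| ≥ e+1. -/

import Mathlib

open Polynomial Matrix

/-- `u` has eccentricity `e` in `G`. -/
def IsEcc {V : Type*} (G : SimpleGraph V) (u : V) (e : ℕ) : Prop :=
  (∀ v, G.dist u v ≤ e) ∧ ∃ v, G.dist u v = e

/-- The eigenvalue support of the vertex `u`: those eigenvalues `θ` of `A` whose spectral
idempotent `E_θ` satisfies `E_θ e_u ≠ 0`, equivalently those `θ` admitting an eigenvector
not vanishing at `u`. -/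
def eSupport {V : Type*} [Fintype V] (A : Matrix V V ℝ) (u : V) : Set ℝ :=
  {θ : ℝ | ∃ w : V → ℝ, A *ᵥ w = θ • w ∧ w u ≠ 0}

/-- A polynomial in `A` acts on an eigenvector of `A` by evaluation at the eigenvalue. -/
theorem aeval_mulVec_of_mulVec_eq_smul {V : Type*} [Fintype V] [DecidableEq V]
    {A : Matrix V V ℝ} {w : V → ℝ} {θ : ℝ} (h : A *ᵥ w = θ • w) (p : ℝ[X]) :
    aeval A p *ᵥ w = p.eval θ • w := by
  have hpow : ∀ n : ℕ, (A ^ n) *ᵥ w = θ ^ n • w := by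
    intro n
    induction n with
    | zero => simp
    | succ n ih => rw [pow_succ, ← mulVec_mulVec, h, mulVec_smul, ih, smul_smul, pow_succ']
  rw [aeval_eq_sum_range, eval_eq_sum_range, sum_mulVec, Finset.sum_smul]
  refine Finset.sum_congr rfl fun n _ => ?_
  rw [smul_mulVec, hpow, smul_smul]

/-- The eigenvalue support of a vertex is finite. -/
theorem finite_eSupport {V : Type*} [Fintype V] (A : Matrix V V ℝ) (u : V) :
    (eSupport A u).Finite := by
  classical
  refine (Module.End.finite_hasEigenvalue (toLin' A)).subset ?_
  rintro θ ⟨w, hw, hwu⟩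
  refine Module.End.hasEigenvalue_of_hasEigenvector (x := w)
    ⟨Module.End.mem_eigenspace_iff.mpr (by simpa using hw), ?_⟩
  rintro rfl
  exact hwu rfl

/-- If `p` vanishes on the eigenvalue support of `u`, then row `u` of `p(A)` is zero. -/
theorem Matrix.IsHermitian.aeval_apply_eq_zero {V : Type*} [Fintype V] [DecidableEq V]
    {A : Matrix V V ℝ} (hA : A.IsHermitian) {u : V} {p : ℝ[X]}
    (hp : ∀ θ ∈ eSupport A u, p.eval θ = 0) (v : V) : aeval A p u v = 0 := by
  have hzero : LinearMap.proj u ∘ₗ toLin' (aeval A p) = 0 := by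
    refine (hA.eigenvectorBasis.toBasis.map (WithLp.linearEquiv 2 ℝ (V → ℝ))).ext fun i => ?_
    have hw := hA.mulVec_eigenvectorBasis i
    have hpw := aeval_mulVec_of_mulVec_eq_smul hw p
    by_cases hu : (hA.eigenvectorBasis i).ofLp u = 0
    · simpa [hu] using congrFun hpw u
    · simpa [hp _ ⟨_, hw, hu⟩] using congrFun hpw u
  simpa using LinearMap.congr_fun hzero (Pi.single v 1)

/-- The entry of `p(A)` at vertices whose distance is the degree of the monic polynomial `p`
is nonzero. -/
theorem SimpleGraph.aeval_adjMatrix_apply_ne_zero {V : Type*} [Fintype V] [DecidableEq V]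
    {G : SimpleGraph V} [DecidableRel G.Adj] (hconn : G.Connected) {u v : V} {p : ℝ[X]}
    (hp : p.Monic) (hdeg : p.natDegree = G.dist u v) : aeval (G.adjMatrix ℝ) p u v ≠ 0 := by
  have hlow : ∀ n < G.dist u v, (G.adjMatrix ℝ ^ n) u v = 0 := by
    intro n hn
    rw [adjMatrix_pow_apply_eq_card_walk, Nat.cast_eq_zero, Fintype.card_eq_zero_iff]
    exact ⟨fun w => (G.dist_le w.1).not_gt (w.2.symm ▸ hn)⟩
  have htop : (G.adjMatrix ℝ ^ G.dist u v) u v ≠ 0 := by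
    obtain ⟨w, hw⟩ := hconn.exists_walk_length_eq_dist u v
    rw [adjMatrix_pow_apply_eq_card_walk, Nat.cast_ne_zero]
    exact (Fintype.card_pos_iff.mpr ⟨⟨w, hw⟩⟩).ne'
  rw [aeval_eq_sum_range, Finset.sum_range_succ, hp.coeff_natDegree, hdeg, Matrix.add_apply,
    Matrix.sum_apply, Finset.sum_eq_zero fun n hn => ?_]
  · simpa using htop
  · simp [hlow n (Finset.mem_range.mp hn)]

/-- The eigenvalue support of a vertex of eccentricity `e` has at least `e + 1` elements. -/
theorem eccentricity_lt_support_card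
    {V : Type*} [Fintype V] [DecidableEq V] (G : SimpleGraph V) [DecidableRel G.Adj]
    (hconn : G.Connected) (u : V) (e : ℕ) (hecc : IsEcc G u e) :
    e + 1 ≤ (eSupport (G.adjMatrix ℝ) u).ncard := by
  obtain ⟨-, v, rfl⟩ := hecc
  have hfin := finite_eSupport (G.adjMatrix ℝ) u
  rw [Set.ncard_eq_toFinset_card _ hfin]
  by_contra! hlt
  set S := hfin.toFinset
  have hmonic : (∏ θ ∈ S, (X - C θ)).Monic := monic_prod_X_sub_C _ _
  refine SimpleGraph.aeval_adjMatrix_apply_ne_zero hconn (u := u) (v := v)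
    (p := X ^ (G.dist u v - S.card) * ∏ θ ∈ S, (X - C θ)) ((monic_X_pow _).mul hmonic) ?_ ?_
  · rw [(monic_X_pow _).natDegree_mul hmonic, natDegree_X_pow,
      natDegree_finsetProd_X_sub_C_eq_card]
    omega
  · refine Matrix.IsHermitian.aeval_apply_eq_zero
      (isHermitian_iff_isSymm.mpr G.isSymm_adjMatrix) (fun θ hθ => ?_) v
    rw [eval_mul, eval_prod, Finset.prod_eq_zero (hfin.mem_toFinset.mpr hθ) (by simp), mul_zero]
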